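/- Let n be even and let f be a monotone Boolean function of n variables such that every minimal one of f lies in one of the layers E^{n,n/2-1}, E^{n,n/2}, E^{n,n/2+1}, and f(x) = 1 for every x with at least n/2+2 ones. Then for every j \in \{1,...,n\}: 2^{n-1} \alpha_j^f = A + B + C + D, where A = #\{x \in E^{n,n/2-1} : f(x) = 1, x_j = 1\}, B = #\{x \in E^{n,n/2-1} : f(x) = 0, x_j = 0, f(x \oplus e_j) = 1\}, C = #\{x \in E^{n,n/2+1} : f(x) = 0, x_j = 0\}, and D = #\{x \in E^{n,n/2+1} : f(x) = 1, x_j = 1, f(x \oplus e_j) = 0\}. -/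

import Mathlib

open Finset

/-- `x` with its `j`-th coordinate set to `b`. -/
def setCoord {n : ℕ} (x : Fin n → Bool) (j : Fin n) (b : Bool) : Fin n → Bool :=
  Function.update x j b

/-- `x` with its `j`-th coordinate flipped (`x ⊕ e_j`). -/
def flipCoord {n : ℕ} (x : Fin n → Bool) (j : Fin n) : Fin n → Bool :=
  Function.update x j (!x j)

/-- Number of ones of a Boolean vector. -/
def weight {n : ℕ} (x : Fin n → Bool) : ℕ :=
  (Finset.univ.filter fun i => x i = true).card

/-- The activity `α_j^f = 2^{-n} ∑_x (f(x^{(j,0)}) ⊕ f(x^{(j,1)}))`. -/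
noncomputable def activity {n : ℕ} (f : (Fin n → Bool) → Bool) (j : Fin n) : ℝ :=
  (2 ^ n : ℝ)⁻¹ * ∑ x : Fin n → Bool,
    (if f (setCoord x j false) ≠ f (setCoord x j true) then (1 : ℝ) else 0)

/-- The sensitivity `s^f(x)` of `f` at `x`. -/
def sensAt {n : ℕ} (f : (Fin n → Bool) → Bool) (x : Fin n → Bool) : ℕ :=
  (Finset.univ.filter fun i => f (flipCoord x i) ≠ f x).card

/-- The average sensitivity `s^f`. -/
noncomputable def avgSens {n : ℕ} (f : (Fin n → Bool) → Bool) : ℝ :=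
  (2 ^ n : ℝ)⁻¹ * ∑ x : Fin n → Bool, (sensAt f x : ℝ)

/-- `x` is a minimal one of the (monotone) function `f`. -/
def MinimalOne {n : ℕ} (f : (Fin n → Bool) → Bool) (x : Fin n → Bool) : Prop :=
  f x = true ∧ ∀ y, y < x → f y = false

/-- `x` is a maximal zero of the (monotone) function `f`. -/
def MaximalZero {n : ℕ} (f : (Fin n → Bool) → Bool) (x : Fin n → Bool) : Prop :=
  f x = false ∧ ∀ y, x < y → f y = true

theorem flipCoord_apply_self {n : ℕ} (x : Fin n → Bool) (j : Fin n) :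
    flipCoord x j j = !x j := by
  simp [flipCoord]

theorem flipCoord_flipCoord {n : ℕ} (x : Fin n → Bool) (j : Fin n) :
    flipCoord (flipCoord x j) j = x := by
  simp [flipCoord]

theorem weight_mono {n : ℕ} : Monotone (weight : (Fin n → Bool) → ℕ) := by
  intro x y h
  refine Finset.card_le_card fun i hi => ?_
  simp only [Finset.mem_filter, Finset.mem_univ, true_and] at hi ⊢
  exact Bool.eq_true_of_true_le (hi ▸ h i)

theorem weight_flipCoord {n : ℕ} {x : Fin n → Bool} {j : Fin n} (h : x j = false) :
    weight (flipCoord x j) = weight x + 1 := by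
  have hset : (Finset.univ.filter fun i => flipCoord x j i = true) =
      insert j (Finset.univ.filter fun i => x i = true) := by
    ext i
    by_cases hi : i = j
    · subst hi
      simp [flipCoord, h]
    · have hne : flipCoord x j i = x i := Function.update_of_ne hi _ _
      simp [hi, hne]
  rw [weight, hset, Finset.card_insert_of_notMem (by simp [h]), weight]

theorem le_flipCoord {n : ℕ} {x : Fin n → Bool} {j : Fin n} (h : x j = false) :
    x ≤ flipCoord x j := by
  simp [flipCoord, h]

theorem sum_flipCoord {n : ℕ} {M : Type*} [AddCommMonoid M] (g : (Fin n → Bool) → M)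
    (j : Fin n) : ∑ x, g (flipCoord x j) = ∑ x, g x :=
  Equiv.sum_comp (Function.Involutive.toPerm (fun x => flipCoord x j)
    fun x => flipCoord_flipCoord x j) g

theorem exists_minimalOne_le {n : ℕ} {f : (Fin n → Bool) → Bool} {x : Fin n → Bool}
    (hx : f x = true) : ∃ z ≤ x, MinimalOne f z := by
  obtain ⟨z, hzx, hz⟩ := (Set.toFinite {y | f y = true}).exists_le_minimal hx
  refine ⟨z, hzx, hz.prop, fun y hy => ?_⟩
  by_contra hfy
  exact hz.not_prop_of_lt hy (by simpa using hfy)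

theorem ncard_setOf_eq_sum {α : Type*} [Fintype α] (p : α → Prop) [DecidablePred p] :
    ({x | p x}.ncard : ℝ) = ∑ x, if p x then (1 : ℝ) else 0 := by
  rw [Finset.sum_boole, Set.ncard_eq_toFinset_card']
  simp

/-- For monotone `f`, `2^{n-1} α_j^f` counts the edges in direction `j` on which `f` changes,
each indexed by its lower endpoint. -/
theorem two_pow_mul_activity {n : ℕ} {f : (Fin n → Bool) → Bool} (hf : Monotone f)
    (j : Fin n) :
    (2 : ℝ) ^ (n - 1) * activity f j =
      ∑ x, if x j = false ∧ f x = false ∧ f (flipCoord x j) = true then (1 : ℝ) else 0 := by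
  have hsum : (∑ x : Fin n → Bool,
      if f (setCoord x j false) ≠ f (setCoord x j true) then (1 : ℝ) else 0) =
      2 * ∑ x, if x j = false ∧ f x = false ∧ f (flipCoord x j) = true
        then (1 : ℝ) else 0 := by
    rw [two_mul]
    nth_rewrite 2 [← sum_flipCoord _ j]
    rw [← Finset.sum_add_distrib]
    refine Finset.sum_congr rfl fun x _ => ?_
    rw [flipCoord_flipCoord, flipCoord_apply_self]
    cases hx : x j
    · have hfalse : setCoord x j false = x := by simp [setCoord, ← hx]
      have htrue : setCoord x j true = flipCoord x j := by simp [setCoord, flipCoord, hx]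
      have hle := hf (le_flipCoord hx)
      rw [hfalse, htrue]
      cases h : f x <;> cases h' : f (flipCoord x j) <;>
        simp_all [Bool.le_iff_imp]
    · have htrue : setCoord x j true = x := by simp [setCoord, ← hx]
      have hfalse : setCoord x j false = flipCoord x j := by simp [setCoord, flipCoord, hx]
      have hle := hf (le_flipCoord (x := flipCoord x j) (j := j)
        (by simp [flipCoord_apply_self, hx]))
      rw [flipCoord_flipCoord] at hle
      rw [hfalse, htrue]
      cases h : f x <;> cases h' : f (flipCoord x j) <;>
        simp_all [Bool.le_iff_imp]
  have hpow : (2 : ℝ) ^ n = 2 ^ (n - 1) * 2 := by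
    rw [← pow_succ, Nat.sub_add_cancel j.pos]
  rw [activity, hsum, hpow]
  field_simp

/-- even `n`: decomposition of `2^{n-1} α_j^f` into the four relevant counts
for a monotone function whose minimal ones lie in the three middle layers and which equals
`1` from layer `n/2+2` upward. -/
theorem activity_decomposition_even (n : ℕ) (hn : Even n) (f : (Fin n → Bool) → Bool)
    (hf : Monotone f)
    (hmin : ∀ x, MinimalOne f x →
      weight x = n / 2 - 1 ∨ weight x = n / 2 ∨ weight x = n / 2 + 1)
    (hone : ∀ x, n / 2 + 2 ≤ weight x → f x = true) (j : Fin n) :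
    (2 : ℝ) ^ (n - 1) * activity f j =
      ({x : Fin n → Bool | weight x = n / 2 - 1 ∧ f x = true ∧ x j = true}.ncard : ℝ) +
      ({x : Fin n → Bool | weight x = n / 2 - 1 ∧ f x = false ∧ x j = false ∧
          f (flipCoord x j) = true}.ncard : ℝ) +
      ({x : Fin n → Bool | weight x = n / 2 + 1 ∧ f x = false ∧ x j = false}.ncard : ℝ) +
      ({x : Fin n → Bool | weight x = n / 2 + 1 ∧ f x = true ∧ x j = true ∧
          f (flipCoord x j) = false}.ncard : ℝ) := by
  have hn2 : 1 ≤ n / 2 := by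
    have := j.pos
    obtain ⟨k, rfl⟩ := hn
    omega
  have hzero : ∀ x, weight x < n / 2 - 1 → f x = false := by
    intro x hx
    by_contra hfx
    obtain ⟨z, hzx, hz⟩ := exists_minimalOne_le (by simpa using hfx)
    have := weight_mono hzx
    have := hmin z hz
    omega
  rw [two_pow_mul_activity hf, ncard_setOf_eq_sum, ncard_setOf_eq_sum, ncard_setOf_eq_sum,
    ncard_setOf_eq_sum,
    ← sum_flipCoord (fun x => if weight x = n / 2 - 1 ∧ f x = true ∧ x j = true
      then (1 : ℝ) else 0) j,
    ← sum_flipCoord (fun x => if weight x = n / 2 + 1 ∧ f x = true ∧ x j = true ∧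
      f (flipCoord x j) = false then (1 : ℝ) else 0) j,
    ← Finset.sum_add_distrib, ← Finset.sum_add_distrib, ← Finset.sum_add_distrib]
  refine Finset.sum_congr rfl fun x _ => ?_
  simp only [flipCoord_flipCoord, flipCoord_apply_self]
  cases hx : x j
  · have hw := weight_flipCoord hx
    have hle := hf (le_flipCoord hx)
    have hzx := hzero x
    have hzy := hzero (flipCoord x j)
    have hox := hone x
    have hoy := hone (flipCoord x j)
    rw [hw] at hzy hoy ⊢
    cases h : f x <;> cases h' : f (flipCoord x j) <;> simp [h, h'] at hle hzx hzy hox hoy ⊢ <;>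
      grind
  · simp
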